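/- Let y' = (y'_I) be a vector in the polytope SA_t(n), and define a new vector y = (y_I) by y_I := (y'_I + y'_{I,∅})/2 for every I with |I| ≤ t. Then: (i) y ∈ SA_t(n); (ii) y is symmetric, i.e. y_{I,J} = y_{J,I} for all I, J with |I ∪ J| ≤ t; (iii) y_∅ = y'_∅ and y_{i≠j} = y'_{i≠j} for all i ≠ j in {1,…,n}; and (iv) if y_∅ > 0 then ỹ_{{i}} = 1/2 for every i ∈ {1,…,n}. -/

import Mathlib

open Finset

/-- `y_{I,J} = ∑_{I' ⊆ I} (-1)^{|I'|} y_{I' ∪ J}`. -/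
def saIJ {n : ℕ} (y : Finset (Fin n) → ℝ) (I J : Finset (Fin n)) : ℝ :=
  ∑ I' ∈ I.powerset, (-1 : ℝ) ^ I'.card * y (I' ∪ J)

/-- Membership in the Sherali–Adams polytope `SA_t(n)`. -/
def memSA {n : ℕ} (t : ℕ) (y : Finset (Fin n) → ℝ) : Prop :=
  ∀ I J : Finset (Fin n), (I ∪ J).card ≤ t → 0 ≤ saIJ y I J

/-- `y_{i≠j} = y_{{i},{j}} + y_{{j},{i}}`. -/
def yNeq {n : ℕ} (y : Finset (Fin n) → ℝ) (i j : Fin n) : ℝ :=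
  saIJ y {i} {j} + saIJ y {j} {i}

@[simp]
theorem saIJ_empty_left {n : ℕ} (y : Finset (Fin n) → ℝ) (J : Finset (Fin n)) :
    saIJ y ∅ J = y J := by
  simp [saIJ]

theorem saIJ_insert {n : ℕ} (y : Finset (Fin n) → ℝ) {a : Fin n} {I : Finset (Fin n)}
    (ha : a ∉ I) (J : Finset (Fin n)) :
    saIJ y (insert a I) J = saIJ y I J - saIJ y I (insert a J) := by
  unfold saIJ
  rw [sum_powerset_insert ha, sub_eq_add_neg, ← sum_neg_distrib]
  congr 1
  refine sum_congr rfl fun K hK => ?_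
  have haK : a ∉ K := fun h => ha (mem_powerset.1 hK h)
  rw [card_insert_of_notMem haK, insert_union, ← union_insert, pow_succ]
  ring

theorem saIJ_eq_zero_of_mem {n : ℕ} (y : Finset (Fin n) → ℝ) {a : Fin n}
    {I J : Finset (Fin n)} (hI : a ∈ I) (hJ : a ∈ J) : saIJ y I J = 0 := by
  rw [← insert_erase hI, saIJ_insert y (notMem_erase a I), insert_eq_of_mem hJ, sub_self]

/-- Replacing `y_I` by `y_{I,∅}` (complementing every variable) swaps the two indices. -/
theorem saIJ_complement {n : ℕ} (y : Finset (Fin n) → ℝ) (I J : Finset (Fin n)) :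
    saIJ (fun K => saIJ y K ∅) I J = saIJ y J I := by
  induction I using Finset.induction_on generalizing J with
  | empty => simp
  | insert a I ha ih =>
    rw [saIJ_insert _ ha, ih, ih]
    by_cases hJ : a ∈ J
    · rw [insert_eq_of_mem hJ, sub_self, saIJ_eq_zero_of_mem y hJ (mem_insert_self a I)]
    · rw [saIJ_insert y hJ, sub_sub_cancel]

theorem saIJ_symmetrize {n : ℕ} {y y' : Finset (Fin n) → ℝ}
    (hy : ∀ I, y I = (y' I + saIJ y' I ∅) / 2) (I J : Finset (Fin n)) :
    saIJ y I J = (saIJ y' I J + saIJ y' J I) / 2 := by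
  rw [← saIJ_complement y' I J]
  conv_lhs => unfold saIJ
  rw [saIJ, saIJ, ← sum_add_distrib, sum_div]
  refine sum_congr rfl fun K _ => ?_
  rw [hy]
  ring

/-- symmetrizing a Sherali–Adams solution.  Given `y' ∈ SA_t(n)`, the vector
`y_I := (y'_I + y'_{I,∅})/2` lies in `SA_t(n)`, is symmetric, preserves `y_∅` and all the
values `y_{i≠j}`, and (when `y_∅ > 0`) satisfies `ỹ_{{i}} = 1/2` for every vertex `i`. -/
theorem stmt5 (n t : ℕ) (hn : 1 ≤ n) (ht : 1 ≤ t)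
    (y' : Finset (Fin n) → ℝ) (hSA : memSA t y')
    (y : Finset (Fin n) → ℝ) (hy : ∀ I, y I = (y' I + saIJ y' I ∅) / 2) :
    memSA t y ∧
    (∀ I J : Finset (Fin n), (I ∪ J).card ≤ t → saIJ y I J = saIJ y J I) ∧
    y ∅ = y' ∅ ∧
    (∀ i j : Fin n, i ≠ j → yNeq y i j = yNeq y' i j) ∧
    (0 < y ∅ → ∀ i : Fin n, y {i} / y ∅ = 1 / 2) := by
  have key := saIJ_symmetrize hy
  have h_empty : y ∅ = y' ∅ := by simp [hy]
  refine ⟨fun I J h => ?_, fun I J _ => ?_, h_empty, fun i j _ => ?_, fun hpos i => ?_⟩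
  · have h₁ := hSA I J h
    have h₂ := hSA J I (union_comm I J ▸ h)
    rw [key]
    positivity
  · rw [key, key, add_comm]
  · rw [yNeq, yNeq, key, key]
    ring
  · have hi : y {i} = y ∅ / 2 := by
      rw [hy, h_empty, ← insert_empty_eq i, saIJ_insert y' (notMem_empty i)]
      simp
    rw [hi]
    field_simp
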